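/- Let X be a standard Gaussian random variable and let Y = H₄(X) = X⁴ − 6X² + 3. Define the operator S₄ f(y) = y f(y) − (24 + 44y) f'(y) + (576 + 144y − 16y²) f''(y) + (192y² + 576y − 3456) f^{(3)}(y). Let W be a real-valued random variable with E[W²] < ∞. Then W is equal in law to H₄(X) if and only if E[S₄ f(W)] = 0 for all f ∈ F_{S₄,Y}. -/

import Mathlib

open MeasureTheory ProbabilityTheory Filter Set
open scoped Topology

/-- The standard Gaussian distribution, with density `(2π)^(-1/2) exp(-x²/2)` on `ℝ`. -/
noncomputable def stdGaussian : Measure ℝ :=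
  volume.withDensity fun x =>
    ENNReal.ofReal ((Real.sqrt (2 * Real.pi))⁻¹ * Real.exp (-x ^ 2 / 2))

/-- The law of `H₄(X) = X⁴ - 6X² + 3` for `X` standard Gaussian. -/
noncomputable def lawH4 : Measure ℝ :=
  Measure.map (fun x : ℝ => x ^ 4 - 6 * x ^ 2 + 3) stdGaussian

/-- The Stein operator `S₄ f(y) = y f(y) - (24 + 44y) f'(y) + (576 + 144y - 16y²) f''(y)
+ (192y² + 576y - 3456) f⁽³⁾(y)` for `H₄(X)`. -/
noncomputable def steinH4 (f : ℝ → ℝ) (y : ℝ) : ℝ :=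
  y * f y - (24 + 44 * y) * deriv f y + (576 + 144 * y - 16 * y ^ 2) * iteratedDeriv 2 f y
    + (192 * y ^ 2 + 576 * y - 3456) * iteratedDeriv 3 f y

/-- Membership in the class `F_{S₄,Y}` (here `T = 3`, `m = 2`, `I = ℝ`). -/
def memFH4 (f : ℝ → ℝ) : Prop :=
  ContDiff ℝ 3 f ∧
    ∀ t ≤ 3, ∀ j ≤ 2, Integrable (fun y => y ^ j * iteratedDeriv t f y) lawH4

noncomputable def gamH4 (x : ℝ) : ℝ := (Real.sqrt (2 * Real.pi))⁻¹ * Real.exp (-x ^ 2 / 2)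

lemma gamH4_cont : Continuous gamH4 := by unfold gamH4; fun_prop

lemma gamH4_nonneg (x : ℝ) : 0 ≤ gamH4 x := by unfold gamH4; positivity

lemma gamH4_deriv (x : ℝ) : HasDerivAt gamH4 (-x * gamH4 x) x := by
  have h : HasDerivAt (fun x : ℝ => -x ^ 2 / 2) (-x) x := by
    have := ((hasDerivAt_pow 2 x).neg).div_const 2
    refine HasDerivAt.congr_deriv this ?_
    simp; ring
  have := (h.exp).const_mul ((Real.sqrt (2 * Real.pi))⁻¹)
  unfold gamH4
  refine HasDerivAt.congr_deriv this ?_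
  ring

lemma stdGaussian_eq : _root_.stdGaussian = volume.withDensity fun x => ENNReal.ofReal (gamH4 x) := rfl

lemma stdGaussian_eq' : _root_.stdGaussian = gaussianReal 0 1 := by
  rw [gaussianReal_of_var_ne_zero 0 one_ne_zero]
  unfold _root_.stdGaussian gaussianPDF gaussianPDFReal
  simp

lemma integrable_lawH4_iff (g : ℝ → ℝ) (hg : Continuous g) :
    Integrable g lawH4 ↔ Integrable (fun x => gamH4 x * g (x ^ 4 - 6 * x ^ 2 + 3)) := by
  unfold lawH4
  rw [integrable_map_measure hg.aestronglyMeasurable (by fun_prop), stdGaussian_eq,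
    integrable_withDensity_iff_integrable_smul' (gamH4_cont.measurable.ennreal_ofReal) (by simp)]
  simp [Function.comp_def, ENNReal.toReal_ofReal (gamH4_nonneg _)]

lemma integral_lawH4 (g : ℝ → ℝ) (hg : Continuous g) :
    ∫ y, g y ∂lawH4 = ∫ x, gamH4 x * g (x ^ 4 - 6 * x ^ 2 + 3) := by
  unfold lawH4
  rw [integral_map (by fun_prop) hg.aestronglyMeasurable, stdGaussian_eq,
    integral_withDensity_eq_integral_toReal_smul (gamH4_cont.measurable.ennreal_ofReal) (by simp)]
  simp [ENNReal.toReal_ofReal (gamH4_nonneg _)]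

instance : IsProbabilityMeasure lawH4 := by
  unfold lawH4
  rw [stdGaussian_eq']
  exact Measure.isProbabilityMeasure_map (by fun_prop)

lemma lawH4_sq : Integrable (fun y : ℝ => y ^ 2) lawH4 := by
  unfold lawH4
  rw [integrable_map_measure (by fun_prop) (by fun_prop), stdGaussian_eq']
  have h : ∀ n : ℕ, Integrable (fun x : ℝ => x ^ n) (gaussianReal 0 1) := by
    intro n
    have := (memLp_id_gaussianReal (μ := 0) (v := 1) n).integrable_norm_pow'
    refine (integrable_norm_iff (by fun_prop)).1 ?_
    simpa using this
  have : ((fun y : ℝ => y ^ 2) ∘ fun x : ℝ => x ^ 4 - 6 * x ^ 2 + 3) =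
      fun x => x ^ 8 - 12 * x ^ 6 + 42 * x ^ 4 - 36 * x ^ 2 + 9 := by
    ext x; simp only [Function.comp]; ring
  rw [this]
  exact (((((h 8).sub ((h 6).const_mul 12)).add ((h 4).const_mul 42)).sub
    ((h 2).const_mul 36)).add (integrable_const 9))

lemma iter_deriv_aux {f : ℝ → ℝ} (hf : ContDiff ℝ 3 f) (k : ℕ) (hk : k < 3) (y : ℝ) :
    HasDerivAt (iteratedDeriv k f) (iteratedDeriv (k + 1) f y) y := by
  rw [iteratedDeriv_succ]
  exact ((hf.differentiable_iteratedDeriv k (by exact_mod_cast hk)) y).hasDerivAt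

lemma iter_cont_aux {f : ℝ → ℝ} (hf : ContDiff ℝ 3 f) (k : ℕ) (hk : k ≤ 3) :
    Continuous (iteratedDeriv k f) :=
  hf.continuous_iteratedDeriv k (by exact_mod_cast hk)

lemma steinH4_cont {f : ℝ → ℝ} (hf : ContDiff ℝ 3 f) : Continuous (steinH4 f) := by
  have h0 := iter_cont_aux hf 0 (by norm_num)
  have h1 := iter_cont_aux hf 1 (by norm_num)
  have h2 := iter_cont_aux hf 2 (by norm_num)
  have h3 := iter_cont_aux hf 3 (by norm_num)
  rw [iteratedDeriv_zero] at h0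
  rw [iteratedDeriv_one] at h1
  unfold steinH4
  fun_prop

lemma bound_aux (x : ℝ) (c : ℝ) (hc : 0 ≤ c) (b : ℝ)
    (hb : |b| ≤ c * (1 + x ^ 8)) : |b| ≤ (10000 * c) * (1 + (x ^ 4 - 6 * x ^ 2 + 3) ^ 2) := by
  have : 1 + x ^ 8 ≤ 10000 * (1 + (x ^ 4 - 6 * x ^ 2 + 3) ^ 2) := by
    nlinarith [sq_nonneg (x ^ 4 - 12 * x ^ 2), sq_nonneg (x ^ 4 - 6 * x ^ 2 + 3), sq_nonneg (x^2), sq_nonneg (x ^ 2 - 3)]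
  nlinarith

lemma int_aux {g : ℝ → ℝ} (hg : Continuous g)
    (h0 : Integrable g lawH4) (h2 : Integrable (fun y => y ^ 2 * g y) lawH4)
    (b : ℝ → ℝ) (hbc : Continuous b) (c : ℝ) (hc : 0 ≤ c)
    (hb : ∀ x, |b x| ≤ c * (1 + x ^ 8)) :
    Integrable (fun x => gamH4 x * b x * g (x ^ 4 - 6 * x ^ 2 + 3)) := by
  rw [integrable_lawH4_iff _ hg] at h0
  rw [integrable_lawH4_iff _ (by fun_prop)] at h2
  have hgc := gamH4_cont
  refine ((h0.norm.add h2.norm).const_mul (10000 * c)).mono' ?_ ?_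
  · exact Continuous.aestronglyMeasurable (by fun_prop)
  · refine Eventually.of_forall fun x => ?_
    have := bound_aux x c hc _ (hb x)
    simp only [Real.norm_eq_abs, abs_mul, Pi.add_apply]
    have h1 : |(x ^ 4 - 6 * x ^ 2 + 3) ^ 2| = (x ^ 4 - 6 * x ^ 2 + 3) ^ 2 := abs_of_nonneg (by positivity)
    rw [h1]
    have h3 := mul_le_mul_of_nonneg_left this
      (show 0 ≤ |gamH4 x| * |g (x ^ 4 - 6 * x ^ 2 + 3)| by positivity)
    linarith

lemma stein_forward {f : ℝ → ℝ} (hf : memFH4 f) : ∫ y, steinH4 f y ∂lawH4 = 0 := by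
  obtain ⟨hf, hi⟩ := hf
  rw [integral_lawH4 _ (steinH4_cont hf)]
  have hc0 := iter_cont_aux hf 0 (by norm_num)
  have hc1 := iter_cont_aux hf 1 (by norm_num)
  have hc2 := iter_cont_aux hf 2 (by norm_num)
  have I : ∀ t ≤ 3, ∀ b : ℝ → ℝ, Continuous b → ∀ c : ℝ, 0 ≤ c → (∀ x, |b x| ≤ c * (1 + x ^ 8)) →
      Integrable (fun x => gamH4 x * b x * iteratedDeriv t f (x ^ 4 - 6 * x ^ 2 + 3)) := by
    intro t ht b hb c hc hbc
    exact int_aux (iter_cont_aux hf t ht) (by simpa using hi t ht 0 (by norm_num))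
      (hi t ht 2 le_rfl) b hb c hc hbc
  have hpow : ∀ x : ℝ, |x| ≤ 1 + x ^ 8 ∧ |x| ^ 3 ≤ 1 + x ^ 8 ∧ |x| ^ 5 ≤ 1 + x ^ 8 := by
    intro x
    have h8 : x ^ 8 = |x| ^ 8 := (Even.pow_abs (by decide) x).symm
    rw [h8]
    have hx := abs_nonneg x
    rcases le_total |x| 1 with h | h
    · exact ⟨by nlinarith [pow_nonneg hx 8], by nlinarith [pow_nonneg hx 8, pow_le_one₀ (n := 3) hx h],
        by nlinarith [pow_nonneg hx 8, pow_le_one₀ (n := 5) hx h]⟩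
    · have := pow_le_pow_right₀ h (show 1 ≤ 8 by norm_num)
      have := pow_le_pow_right₀ h (show 3 ≤ 8 by norm_num)
      have := pow_le_pow_right₀ h (show 5 ≤ 8 by norm_num)
      refine ⟨?_, ?_, ?_⟩ <;> linarith
  have hpoly : ∀ a b c x : ℝ, |a * x ^ 5 + b * x ^ 3 + c * x| ≤ (|a| + |b| + |c|) * (1 + x ^ 8) := by
    intro a b c x
    obtain ⟨h1, h3, h5⟩ := hpow x
    calc |a * x ^ 5 + b * x ^ 3 + c * x| ≤ |a * x ^ 5| + |b * x ^ 3| + |c * x| := abs_add_three _ _ _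
      _ = |a| * |x| ^ 5 + |b| * |x| ^ 3 + |c| * |x| := by simp [abs_mul, abs_pow]
      _ ≤ |a| * (1 + x ^ 8) + |b| * (1 + x ^ 8) + |c| * (1 + x ^ 8) := by gcongr
      _ = _ := by ring
  let B : ℝ → ℝ := fun x =>
    gamH4 x * (0 * x ^ 5 + (-1) * x ^ 3 + 3 * x) * iteratedDeriv 0 f (x ^ 4 - 6 * x ^ 2 + 3)
    + gamH4 x * ((-4) * x ^ 5 + 48 * x ^ 3 + (-156) * x) * iteratedDeriv 1 f (x ^ 4 - 6 * x ^ 2 + 3)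
    + gamH4 x * (48 * x ^ 5 + (-432) * x ^ 3 + 864 * x) * iteratedDeriv 2 f (x ^ 4 - 6 * x ^ 2 + 3)
  have hBi : Integrable B := by
    refine ((I 0 (by norm_num) (fun x => 0 * x ^ 5 + (-1) * x ^ 3 + 3 * x) (by fun_prop) _ ?_ (hpoly _ _ _)).add
      (I 1 (by norm_num) (fun x => (-4) * x ^ 5 + 48 * x ^ 3 + (-156) * x) (by fun_prop) _ ?_ (hpoly _ _ _))).add
      (I 2 (by norm_num) (fun x => 48 * x ^ 5 + (-432) * x ^ 3 + 864 * x) (by fun_prop) _ ?_ (hpoly _ _ _)) <;>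
    positivity
  have hBd : ∀ x, HasDerivAt B (gamH4 x * steinH4 f (x ^ 4 - 6 * x ^ 2 + 3)) x := by
    intro x
    have hH : HasDerivAt (fun x : ℝ => x ^ 4 - 6 * x ^ 2 + 3) (4 * x ^ 3 - 12 * x) x := by
      have := (((hasDerivAt_pow 4 x).sub ((hasDerivAt_pow 2 x).const_mul 6)).add_const 3)
      refine HasDerivAt.congr_deriv this ?_
      norm_num; ring
    have hp : ∀ a b c : ℝ, HasDerivAt (fun x : ℝ => a * x ^ 5 + b * x ^ 3 + c * x)
        (5 * a * x ^ 4 + 3 * b * x ^ 2 + c) x := by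
      intro a b c
      have := (((hasDerivAt_pow 5 x).const_mul a).add ((hasDerivAt_pow 3 x).const_mul b)).add
        ((hasDerivAt_id x).const_mul c)
      refine HasDerivAt.congr_deriv this ?_
      norm_num; ring
    have hk : ∀ k < 3, HasDerivAt (fun x : ℝ => iteratedDeriv k f (x ^ 4 - 6 * x ^ 2 + 3))
        (iteratedDeriv (k + 1) f (x ^ 4 - 6 * x ^ 2 + 3) * (4 * x ^ 3 - 12 * x)) x := fun k hk =>
      HasDerivAt.comp (h₂ := iteratedDeriv k f) x (iter_deriv_aux hf k hk (x ^ 4 - 6 * x ^ 2 + 3)) hH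
    have hg := gamH4_deriv x
    have := (((hg.mul (hp 0 (-1) 3)).mul (hk 0 (by norm_num))).add
      ((hg.mul (hp (-4) 48 (-156))).mul (hk 1 (by norm_num)))).add
      ((hg.mul (hp 48 (-432) 864)).mul (hk 2 (by norm_num)))
    refine HasDerivAt.congr_deriv this ?_
    unfold steinH4
    rw [← iteratedDeriv_one]
    simp only [Pi.mul_apply, iteratedDeriv_zero, zero_add, Nat.reduceAdd]
    ring
  refine integral_eq_zero_of_hasDerivAt_of_integrable hBd ?_ hBi
  rw [← integrable_lawH4_iff _ (steinH4_cont hf)]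
  have J : ∀ t ≤ 3, ∀ a b c : ℝ, Integrable (fun y => (a + b * y + c * y ^ 2) * iteratedDeriv t f y) lawH4 := by
    intro t ht a b c
    have := (((hi t ht 0 (by norm_num)).const_mul a).add ((hi t ht 1 (by norm_num)).const_mul b)).add
      ((hi t ht 2 (by norm_num)).const_mul c)
    refine this.congr (Eventually.of_forall fun y => ?_)
    simp only [Pi.add_apply]
    ring
  refine ((((J 0 (by norm_num) 0 1 0).add (J 1 (by norm_num) (-24) (-44) 0)).add
    (J 2 (by norm_num) 576 144 (-16))).add (J 3 (by norm_num) (-3456) 576 192)).congr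
    (Eventually.of_forall fun y => ?_)
  unfold steinH4
  rw [← iteratedDeriv_one]
  simp only [Pi.add_apply, iteratedDeriv_zero]
  ring

lemma ode_unique (a b p q r s : ℝ → ℝ)
    (ha : ∀ t, HasDerivAt a (p t) t) (hb : ∀ t, HasDerivAt b (q t) t)
    (hp : ∀ t, HasDerivAt p (r t) t) (hq : ∀ t, HasDerivAt q (s t) t)
    (a0 : a 0 = 0) (b0 : b 0 = 0)
    (e1 : ∀ t, q t + 24 * t * b t - 44 * t * p t - 576 * t ^ 2 * a t - 144 * t ^ 2 * q t
      - 16 * t ^ 2 * r t - 192 * t ^ 3 * s t - 576 * t ^ 3 * p t - 3456 * t ^ 3 * b t = 0)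
    (e2 : ∀ t, - p t - 24 * t * a t - 44 * t * q t - 576 * t ^ 2 * b t + 144 * t ^ 2 * p t
      - 16 * t ^ 2 * s t + 192 * t ^ 3 * r t - 576 * t ^ 3 * q t + 3456 * t ^ 3 * a t = 0)
    (t : ℝ) (ht : 0 < t) : a t = 0 ∧ b t = 0 := by
  let w : ℝ → ℝ := fun t => Real.exp (-(3 / 2 * t + 9 * t ^ 2))
  let F : ℝ → ℝ := fun t => w t * (t * (p t * p t + q t * q t) + (a t / t * a t + b t / t * b t))
  let F' : ℝ → ℝ := fun t => w t * (((p t * p t + q t * q t) + 2 * t * (p t * r t + q t * s t)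
    + 2 * (a t * p t + b t * q t) / t - (a t ^ 2 + b t ^ 2) / t ^ 2)
    - (3 / 2 + 18 * t) * (t * (p t * p t + q t * q t) + (a t / t * a t + b t / t * b t)))
  have hw : ∀ t, HasDerivAt w (w t * (-(3 / 2 + 18 * t))) t := by
    intro t
    have h : HasDerivAt (fun t : ℝ => -(3 / 2 * t + 9 * t ^ 2)) (-(3 / 2 + 18 * t)) t := by
      have := (((hasDerivAt_id t).const_mul (3 / 2)).add ((hasDerivAt_pow 2 t).const_mul 9)).neg
      refine HasDerivAt.congr_deriv this ?_
      norm_num; ring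
    exact h.exp
  have hF : ∀ t, 0 < t → HasDerivAt F (F' t) t := by
    intro t ht
    have h1 := (((hasDerivAt_id t).mul (((hp t).mul (hp t)).add ((hq t).mul (hq t)))).add
      ((((ha t).div (hasDerivAt_id t) ht.ne').mul (ha t)).add
        (((hb t).div (hasDerivAt_id t) ht.ne').mul (hb t))))
    have h2 := (hw t).mul h1
    refine HasDerivAt.congr_deriv h2 ?_
    simp only [F', Pi.mul_apply, Pi.add_apply, Pi.div_apply, id]
    field_simp
    ring
  have hF'0 : ∀ t, 0 < t → F' t ≤ 0 := by
    intro t ht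
    have hw0 : 0 ≤ w t := (Real.exp_pos _).le
    refine mul_nonpos_of_nonneg_of_nonpos hw0 ?_
    have E1 := e1 t
    have E2 := e2 t
    generalize a t = a at *
    generalize b t = b at *
    generalize p t = p at *
    generalize q t = q at *
    generalize r t = r at *
    generalize s t = s at *
    have key : 16 * t ^ 2 * (1 + 144 * t ^ 2) * (p * r + q * s) =
        -32 * t * (1 + 72 * t ^ 2) * (p * p + q * q)
        + (1 + 144 * t ^ 2) * (24 * t * (p * b - q * a) - 288 * t ^ 2 * (p * a + q * b)) := by
      linear_combination -(p * (E1 - 12 * t * E2) + q * (E2 + 12 * t * E1))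
    have k2 : 2 * t * (p * r + q * s) ≤ -2 * (p * p + q * q) + 3 * (p * b - q * a)
        - 36 * t * (p * a + q * b) := by
      have hpos : 0 < 8 * t * (1 + 144 * t ^ 2) := by positivity
      refine le_of_mul_le_mul_left ?_ hpos
      have : 0 ≤ t * (p * p + q * q) := mul_nonneg ht.le (add_nonneg (mul_self_nonneg p) (mul_self_nonneg q))
      nlinarith [key]
    have hA : a / t * t = a := by field_simp
    have hB : b / t * t = b := by field_simp
    have g1 : 2 * (a * p + b * q) / t = 2 * (a / t * p + b / t * q) := by ring
    have g2 : (a ^ 2 + b ^ 2) / t ^ 2 = (a / t) ^ 2 + (b / t) ^ 2 := by ring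
    rw [g1, g2]
    generalize a / t = x at *
    generalize b / t = y at *
    subst hA hB
    have m1 : 2 * (p * (y * t) - q * (x * t)) ≤
        t * (p * p + q * q) + (x * (x * t) + y * (y * t)) := by
      have : 0 ≤ t * ((p - y) ^ 2 + (q + x) ^ 2) := by positivity
      nlinarith
    have m2 : -(2 * (p * (x * t) + q * (y * t))) ≤
        t * (p * p + q * q) + (x * (x * t) + y * (y * t)) := by
      have : 0 ≤ t * ((p + x) ^ 2 + (q + y) ^ 2) := by positivity
      nlinarith
    have m3 := mul_le_mul_of_nonneg_left m2 ht.le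
    nlinarith [sq_nonneg (p - x), sq_nonneg (q - y)]
  have hanti : AntitoneOn F (Ioi 0) := by
    refine antitoneOn_of_hasDerivWithinAt_nonpos (convex_Ioi 0) (f' := F') ?_ ?_ ?_
    · exact fun t ht => (hF t ht).continuousAt.continuousWithinAt
    · intro t ht
      rw [interior_Ioi] at ht
      exact (hF t ht).hasDerivWithinAt
    · intro t ht
      rw [interior_Ioi] at ht
      exact hF'0 t ht
  have hlim : Tendsto F (𝓝[>] 0) (𝓝 0) := by
    have c : ∀ (f f' : ℝ → ℝ), (∀ t, HasDerivAt f (f' t) t) → Tendsto f (𝓝[>] 0) (𝓝 (f 0)) :=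
      fun f f' h => (h 0).continuousAt.tendsto.mono_left nhdsWithin_le_nhds
    have d : ∀ (f f' : ℝ → ℝ), f 0 = 0 → (∀ t, HasDerivAt f (f' t) t) →
        Tendsto (fun t => f t / t) (𝓝[>] 0) (𝓝 (f' 0)) := by
      intro f f' h0 h
      have := (hasDerivAt_iff_tendsto_slope_zero.1 (h 0)).mono_left
        (nhdsWithin_mono 0 (show Ioi (0 : ℝ) ⊆ {0}ᶜ from fun x hx => (ne_of_gt hx)))
      refine this.congr fun t => ?_
      simp [h0, div_eq_inv_mul]
    have hid : Tendsto (fun t : ℝ => t) (𝓝[>] 0) (𝓝 0) := tendsto_id.mono_left nhdsWithin_le_nhds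
    have := (c w _ hw).mul ((hid.mul (((c p r hp).mul (c p r hp)).add ((c q s hq).mul (c q s hq)))).add
      (((d a p a0 ha).mul (c a p ha)).add ((d b q b0 hb).mul (c b q hb))))
    simpa [a0, b0] using this
  have hle : F t ≤ 0 := by
    refine ge_of_tendsto hlim ?_
    filter_upwards [Ioo_mem_nhdsGT ht] with u hu
    exact hanti hu.1 ht hu.2.le
  have hw0 : 0 < w t := Real.exp_pos _
  have h3 : t * (p t * p t + q t * q t) + (a t / t * a t + b t / t * b t) ≤ 0 := by
    by_contra h
    push Not at h
    exact absurd (mul_pos hw0 h) (not_lt.2 hle)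
  have h4 : 0 ≤ t * (p t * p t + q t * q t) := by
    have := ht.le
    have := mul_self_nonneg (p t)
    have := mul_self_nonneg (q t)
    positivity
  have h5 : a t / t * a t + b t / t * b t = (a t ^ 2 + b t ^ 2) / t := by ring
  have h6 : (a t ^ 2 + b t ^ 2) / t ≤ 0 := by linarith
  rw [div_le_iff₀ ht] at h6
  constructor <;> nlinarith [sq_nonneg (a t), sq_nonneg (b t)]

lemma pow_integrable_aux (μ : Measure ℝ) [IsProbabilityMeasure μ]
    (h2 : Integrable (fun y : ℝ => y ^ 2) μ) (j : ℕ) (hj : j ≤ 2) :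
    Integrable (fun y : ℝ => y ^ j) μ := by
  refine ((integrable_const (1 : ℝ)).add h2).mono' (by fun_prop) ?_
  refine Eventually.of_forall fun y => ?_
  simp only [Pi.add_apply, Real.norm_eq_abs]
  interval_cases j
  · simp; positivity
  · rw [pow_one, abs_le]; constructor <;> nlinarith [sq_nonneg (y - 1), sq_nonneg (y + 1)]
  · rw [abs_of_nonneg (by positivity)]; linarith

lemma trig_integrable (μ : Measure ℝ) [IsProbabilityMeasure μ]
    (h2 : Integrable (fun y : ℝ => y ^ 2) μ) (j : ℕ) (hj : j ≤ 2)
    (g : ℝ → ℝ) (hg : Continuous g) (hb : ∀ x, |g x| ≤ 1) (t : ℝ) :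
    Integrable (fun y => y ^ j * g (t * y)) μ := by
  refine (pow_integrable_aux μ h2 j hj).norm.mono'
    (Continuous.aestronglyMeasurable (by fun_prop)) (Eventually.of_forall fun y => ?_)
  rw [norm_mul]
  exact mul_le_of_le_one_right (norm_nonneg _) (hb _)

lemma trig_deriv (μ : Measure ℝ) [IsProbabilityMeasure μ]
    (h2 : Integrable (fun y : ℝ => y ^ 2) μ) (j : ℕ) (hj : j + 1 ≤ 2)
    (g g' : ℝ → ℝ) (hg : ∀ x, HasDerivAt g (g' x) x) (hg' : Continuous g')
    (hb : ∀ x, |g x| ≤ 1) (hb' : ∀ x, |g' x| ≤ 1) (t : ℝ) :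
    HasDerivAt (fun t => ∫ y, y ^ j * g (t * y) ∂μ) (∫ y, y ^ (j + 1) * g' (t * y) ∂μ) t := by
  have hgc : Continuous g := continuous_iff_continuousAt.2 fun x => (hg x).continuousAt
  refine (hasDerivAt_integral_of_dominated_loc_of_deriv_le (F := fun t y => y ^ j * g (t * y))
    (F' := fun t y => y ^ (j + 1) * g' (t * y)) (s := univ) (bound := fun y => ‖y ^ (j + 1)‖)
    univ_mem ?_ ?_ ?_ ?_ ?_ ?_).2
  · exact Eventually.of_forall fun t => Continuous.aestronglyMeasurable (by fun_prop)
  · exact trig_integrable μ h2 j (by omega) g hgc hb t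
  · exact Continuous.aestronglyMeasurable (by fun_prop)
  · refine Eventually.of_forall fun y t _ => ?_
    rw [norm_mul]
    exact mul_le_of_le_one_right (norm_nonneg _) (hb' _)
  · exact (pow_integrable_aux μ h2 (j + 1) hj).norm
  · refine Eventually.of_forall fun y t _ => ?_
    have h := (HasDerivAt.comp t (hg (t * y)) ((hasDerivAt_id t).mul_const y)).const_mul (y ^ j)
    refine HasDerivAt.congr_deriv h ?_
    ring

lemma iter_trig (t : ℝ) :
    (deriv (fun y : ℝ => Real.cos (t * y)) = fun y => -t * Real.sin (t * y)) ∧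
    (deriv (fun y : ℝ => Real.sin (t * y)) = fun y => t * Real.cos (t * y)) := by
  constructor
  · ext y
    have := (((hasDerivAt_id y).const_mul t).cos).deriv
    simp only [id] at this
    rw [this]; ring
  · ext y
    have := (((hasDerivAt_id y).const_mul t).sin).deriv
    simp only [id] at this
    rw [this]; ring

lemma iter_cos (t : ℝ) :
    (iteratedDeriv 1 (fun y : ℝ => Real.cos (t * y)) = fun y => -t * Real.sin (t * y)) ∧
    (iteratedDeriv 2 (fun y : ℝ => Real.cos (t * y)) = fun y => -t ^ 2 * Real.cos (t * y)) ∧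
    (iteratedDeriv 3 (fun y : ℝ => Real.cos (t * y)) = fun y => t ^ 3 * Real.sin (t * y)) := by
  have h1 : iteratedDeriv 1 (fun y : ℝ => Real.cos (t * y)) = fun y => -t * Real.sin (t * y) := by
    rw [iteratedDeriv_one, (iter_trig t).1]
  have h2 : iteratedDeriv 2 (fun y : ℝ => Real.cos (t * y)) = fun y => -t ^ 2 * Real.cos (t * y) := by
    rw [iteratedDeriv_succ, h1]
    ext y
    rw [deriv_const_mul_field, (iter_trig t).2]; ring
  refine ⟨h1, h2, ?_⟩
  rw [iteratedDeriv_succ, h2]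
  ext y
  rw [deriv_const_mul_field, (iter_trig t).1]; ring

lemma iter_sin (t : ℝ) :
    (iteratedDeriv 1 (fun y : ℝ => Real.sin (t * y)) = fun y => t * Real.cos (t * y)) ∧
    (iteratedDeriv 2 (fun y : ℝ => Real.sin (t * y)) = fun y => -t ^ 2 * Real.sin (t * y)) ∧
    (iteratedDeriv 3 (fun y : ℝ => Real.sin (t * y)) = fun y => -t ^ 3 * Real.cos (t * y)) := by
  have h1 : iteratedDeriv 1 (fun y : ℝ => Real.sin (t * y)) = fun y => t * Real.cos (t * y) := by
    rw [iteratedDeriv_one, (iter_trig t).2]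
  have h2 : iteratedDeriv 2 (fun y : ℝ => Real.sin (t * y)) = fun y => -t ^ 2 * Real.sin (t * y) := by
    rw [iteratedDeriv_succ, h1]
    ext y
    rw [deriv_const_mul_field, (iter_trig t).1]; ring
  refine ⟨h1, h2, ?_⟩
  rw [iteratedDeriv_succ, h2]
  ext y
  rw [deriv_const_mul_field, (iter_trig t).2]; ring

lemma mem_aux (f : ℝ → ℝ) (hf : ContDiff ℝ 3 f)
    (h : ∀ k ≤ 3, ∃ c : ℝ, ∃ g : ℝ → ℝ, ∃ t : ℝ, Continuous g ∧ (∀ x, |g x| ≤ 1) ∧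
      iteratedDeriv k f = fun y => c * g (t * y)) : memFH4 f := by
  refine ⟨hf, fun k hk j hj => ?_⟩
  obtain ⟨c, g, t, hg, hb, he⟩ := h k hk
  rw [he]
  refine ((trig_integrable lawH4 lawH4_sq j hj g hg hb t).const_mul c).congr
    (Eventually.of_forall fun y => ?_)
  ring

lemma mem_cos (t : ℝ) : memFH4 (fun y => Real.cos (t * y)) := by
  obtain ⟨h1, h2, h3⟩ := iter_cos t
  refine mem_aux _ (by fun_prop) fun k hk => ?_
  interval_cases k
  · exact ⟨1, Real.cos, t, Real.continuous_cos, Real.abs_cos_le_one, by simp⟩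
  · exact ⟨_, Real.sin, t, Real.continuous_sin, Real.abs_sin_le_one, h1⟩
  · exact ⟨_, Real.cos, t, Real.continuous_cos, Real.abs_cos_le_one, h2⟩
  · exact ⟨_, Real.sin, t, Real.continuous_sin, Real.abs_sin_le_one, h3⟩

lemma mem_sin (t : ℝ) : memFH4 (fun y => Real.sin (t * y)) := by
  obtain ⟨h1, h2, h3⟩ := iter_sin t
  refine mem_aux _ (by fun_prop) fun k hk => ?_
  interval_cases k
  · exact ⟨1, Real.sin, t, Real.continuous_sin, Real.abs_sin_le_one, by simp⟩
  · exact ⟨_, Real.cos, t, Real.continuous_cos, Real.abs_cos_le_one, h1⟩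
  · exact ⟨_, Real.sin, t, Real.continuous_sin, Real.abs_sin_le_one, h2⟩
  · exact ⟨_, Real.cos, t, Real.continuous_cos, Real.abs_cos_le_one, h3⟩

noncomputable def mC (μ : Measure ℝ) (j : ℕ) (t : ℝ) : ℝ := ∫ y, y ^ j * Real.cos (t * y) ∂μ
noncomputable def mS (μ : Measure ℝ) (j : ℕ) (t : ℝ) : ℝ := ∫ y, y ^ j * Real.sin (t * y) ∂μ

lemma mC_deriv (μ : Measure ℝ) [IsProbabilityMeasure μ]
    (h2 : Integrable (fun y : ℝ => y ^ 2) μ) (j : ℕ) (hj : j + 1 ≤ 2) (t : ℝ) :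
    HasDerivAt (mC μ j) (-mS μ (j + 1) t) t := by
  have := trig_deriv μ h2 j hj Real.cos (fun x => -Real.sin x) Real.hasDerivAt_cos (by fun_prop)
    Real.abs_cos_le_one (by simpa using Real.abs_sin_le_one) t
  refine HasDerivAt.congr_deriv this ?_
  simp [mS, integral_neg]

lemma mS_deriv (μ : Measure ℝ) [IsProbabilityMeasure μ]
    (h2 : Integrable (fun y : ℝ => y ^ 2) μ) (j : ℕ) (hj : j + 1 ≤ 2) (t : ℝ) :
    HasDerivAt (mS μ j) (mC μ (j + 1) t) t :=
  trig_deriv μ h2 j hj Real.sin Real.cos Real.hasDerivAt_sin (by fun_prop)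
    Real.abs_sin_le_one Real.abs_cos_le_one t

lemma lin_aux (μ : Measure ℝ) [IsProbabilityMeasure μ]
    (h2 : Integrable (fun y : ℝ => y ^ 2) μ) (t c0 c1 c2 d0 d1 d2 : ℝ) :
    ∫ y, (c0 + c1 * y + c2 * y ^ 2) * Real.cos (t * y) + (d0 + d1 * y + d2 * y ^ 2) * Real.sin (t * y) ∂μ
    = c0 * mC μ 0 t + c1 * mC μ 1 t + c2 * mC μ 2 t + d0 * mS μ 0 t + d1 * mS μ 1 t + d2 * mS μ 2 t := by
  have hC : ∀ j ≤ 2, ∀ c : ℝ, Integrable (fun y => c * (y ^ j * Real.cos (t * y))) μ := fun j hj c =>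
    (trig_integrable μ h2 j hj Real.cos Real.continuous_cos Real.abs_cos_le_one t).const_mul c
  have hS : ∀ j ≤ 2, ∀ c : ℝ, Integrable (fun y => c * (y ^ j * Real.sin (t * y))) μ := fun j hj c =>
    (trig_integrable μ h2 j hj Real.sin Real.continuous_sin Real.abs_sin_le_one t).const_mul c
  have i1 := hC 0 (by norm_num) c0
  have i2 := i1.add (hC 1 (by norm_num) c1)
  have i3 := i2.add (hC 2 (by norm_num) c2)
  have i4 := i3.add (hS 0 (by norm_num) d0)
  have i5 := i4.add (hS 1 (by norm_num) d1)
  unfold mC mS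
  simp only [← integral_const_mul]
  rw [← integral_add i1 (hC 1 (by norm_num) c1)]
  erw [← integral_add i2 (hC 2 (by norm_num) c2)]
  erw [← integral_add i3 (hS 0 (by norm_num) d0)]
  erw [← integral_add i4 (hS 1 (by norm_num) d1)]
  erw [← integral_add i5 (hS 2 (by norm_num) d2)]
  congr 1
  ext y
  simp only [Pi.add_apply]
  ring

lemma eq_cos (μ : Measure ℝ) [IsProbabilityMeasure μ]
    (h2 : Integrable (fun y : ℝ => y ^ 2) μ)
    (h : ∀ f : ℝ → ℝ, memFH4 f → ∫ y, steinH4 f y ∂μ = 0) (t : ℝ) :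
    mC μ 1 t + 24 * t * mS μ 0 t + 44 * t * mS μ 1 t - 576 * t ^ 2 * mC μ 0 t
      - 144 * t ^ 2 * mC μ 1 t + 16 * t ^ 2 * mC μ 2 t + 192 * t ^ 3 * mS μ 2 t
      + 576 * t ^ 3 * mS μ 1 t - 3456 * t ^ 3 * mS μ 0 t = 0 := by
  have h0 := h _ (mem_cos t)
  obtain ⟨e1, e2, e3⟩ := iter_cos t
  have hL := lin_aux μ h2 t (-576 * t ^ 2) (1 - 144 * t ^ 2) (16 * t ^ 2)
    (24 * t - 3456 * t ^ 3) (44 * t + 576 * t ^ 3) (192 * t ^ 3)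
  rw [← h0]
  have hX : ∫ y, steinH4 (fun y => Real.cos (t * y)) y ∂μ = ∫ y, (-576 * t ^ 2 + (1 - 144 * t ^ 2) * y + 16 * t ^ 2 * y ^ 2) * Real.cos (t * y) + (24 * t - 3456 * t ^ 3 + (44 * t + 576 * t ^ 3) * y + 192 * t ^ 3 * y ^ 2) * Real.sin (t * y) ∂μ := by
    congr 1
    ext y
    unfold steinH4
    rw [← iteratedDeriv_one, e1, e2, e3]
    ring
  rw [hX, hL]
  ring

lemma eq_sin (μ : Measure ℝ) [IsProbabilityMeasure μ]
    (h2 : Integrable (fun y : ℝ => y ^ 2) μ)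
    (h : ∀ f : ℝ → ℝ, memFH4 f → ∫ y, steinH4 f y ∂μ = 0) (t : ℝ) :
    mS μ 1 t - 24 * t * mC μ 0 t - 44 * t * mC μ 1 t - 576 * t ^ 2 * mS μ 0 t
      - 144 * t ^ 2 * mS μ 1 t + 16 * t ^ 2 * mS μ 2 t - 192 * t ^ 3 * mC μ 2 t
      - 576 * t ^ 3 * mC μ 1 t + 3456 * t ^ 3 * mC μ 0 t = 0 := by
  have h0 := h _ (mem_sin t)
  obtain ⟨e1, e2, e3⟩ := iter_sin t
  have hL := lin_aux μ h2 t (-24 * t + 3456 * t ^ 3) (-44 * t - 576 * t ^ 3) (-192 * t ^ 3)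
    (-576 * t ^ 2) (1 - 144 * t ^ 2) (16 * t ^ 2)
  rw [← h0]
  have hX : ∫ y, steinH4 (fun y => Real.sin (t * y)) y ∂μ = ∫ y, (-24 * t + 3456 * t ^ 3 + (-44 * t - 576 * t ^ 3) * y + -192 * t ^ 3 * y ^ 2) * Real.cos (t * y) + (-576 * t ^ 2 + (1 - 144 * t ^ 2) * y + 16 * t ^ 2 * y ^ 2) * Real.sin (t * y) ∂μ := by
    congr 1
    ext y
    unfold steinH4
    rw [← iteratedDeriv_one, e1, e2, e3]
    ring
  rw [hX, hL]
  ring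

lemma charFun_mCS (μ : Measure ℝ) [IsProbabilityMeasure μ]
    (h2 : Integrable (fun y : ℝ => y ^ 2) μ) (t : ℝ) :
    charFun μ t = (mC μ 0 t : ℂ) + (mS μ 0 t : ℂ) * Complex.I := by
  have hC := trig_integrable μ h2 0 (by norm_num) Real.cos Real.continuous_cos Real.abs_cos_le_one t
  have hS := trig_integrable μ h2 0 (by norm_num) Real.sin Real.continuous_sin Real.abs_sin_le_one t
  rw [charFun_apply_real]
  unfold mC mS
  rw [← integral_complex_ofReal, ← integral_complex_ofReal, ← integral_mul_const, ← integral_add]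
  · congr 1
    ext y
    rw [← Complex.ofReal_mul, Complex.exp_mul_I]
    simp
  · exact hC.ofReal
  · exact hS.ofReal.mul_const _

lemma unique_law (μ η : Measure ℝ) [IsProbabilityMeasure μ] [IsProbabilityMeasure η]
    (h2 : Integrable (fun y : ℝ => y ^ 2) μ) (k2 : Integrable (fun y : ℝ => y ^ 2) η)
    (h : ∀ f : ℝ → ℝ, memFH4 f → ∫ y, steinH4 f y ∂μ = 0)
    (k : ∀ f : ℝ → ℝ, memFH4 f → ∫ y, steinH4 f y ∂η = 0) : μ = η := by
  have main : ∀ t : ℝ, 0 < t → mC μ 0 t - mC η 0 t = 0 ∧ mS μ 0 t - mS η 0 t = 0 := by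
    refine ode_unique (fun t => mC μ 0 t - mC η 0 t) (fun t => mS μ 0 t - mS η 0 t)
      (fun t => -mS μ 1 t - -mS η 1 t) (fun t => mC μ 1 t - mC η 1 t)
      (fun t => -mC μ 2 t - -mC η 2 t) (fun t => -mS μ 2 t - -mS η 2 t) ?_ ?_ ?_ ?_ ?_ ?_ ?_ ?_
    · exact fun t => (mC_deriv μ h2 0 (by norm_num) t).sub (mC_deriv η k2 0 (by norm_num) t)
    · exact fun t => (mS_deriv μ h2 0 (by norm_num) t).sub (mS_deriv η k2 0 (by norm_num) t)
    · exact fun t => (mS_deriv μ h2 1 (by norm_num) t).neg.sub (mS_deriv η k2 1 (by norm_num) t).neg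
    · exact fun t => (mC_deriv μ h2 1 (by norm_num) t).sub (mC_deriv η k2 1 (by norm_num) t)
    · simp [mC]
    · simp [mS]
    · intro t
      linear_combination eq_cos μ h2 h t - eq_cos η k2 k t
    · intro t
      linear_combination eq_sin μ h2 h t - eq_sin η k2 k t
  have hpos : ∀ t : ℝ, 0 < t → charFun μ t = charFun η t := by
    intro t ht
    obtain ⟨e1, e2⟩ := main t ht
    rw [charFun_mCS μ h2, charFun_mCS η k2, sub_eq_zero.1 e1, sub_eq_zero.1 e2]
  apply Measure.ext_of_charFun
  ext t
  rcases lt_trichotomy t 0 with ht | ht | ht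
  · have := hpos (-t) (by linarith)
    rw [charFun_neg, charFun_neg] at this
    exact (starRingEnd ℂ).injective this
  · subst ht; simp
  · exact hpos t ht

/-- Stein characterisation of `H₄(X) = X⁴ - 6X² + 3`, `X ∼ N(0,1)`, via
the operator `S₄` with coefficients of minimal polynomial degree. -/
theorem stein_characterisation_H4
    {Ω : Type*} [MeasurableSpace Ω] (ν : Measure Ω) [IsProbabilityMeasure ν]
    (W : Ω → ℝ) (hW : Measurable W)
    (hWmom : Integrable (fun ω => (W ω) ^ 2) ν) :
    Measure.map W ν = lawH4 ↔
      ∀ f : ℝ → ℝ, memFH4 f → ∫ ω, steinH4 f (W ω) ∂ν = 0 := by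
  have hc : ∀ f : ℝ → ℝ, memFH4 f →
      ∫ ω, steinH4 f (W ω) ∂ν = ∫ y, steinH4 f y ∂(Measure.map W ν) := fun f hf =>
    (integral_map hW.aemeasurable (steinH4_cont hf.1).aestronglyMeasurable).symm
  constructor
  · intro h f hf
    rw [hc f hf, h]
    exact stein_forward hf
  · intro h
    have : IsProbabilityMeasure (Measure.map W ν) := Measure.isProbabilityMeasure_map hW.aemeasurable
    refine unique_law _ _ ?_ lawH4_sq (fun f hf => ?_) (fun f hf => stein_forward hf)
    · rw [integrable_map_measure (by fun_prop) hW.aemeasurable]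
      exact hWmom
    · rw [← hc f hf]; exact h f hf
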